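/- Let α ∈ (0,1), η, L > 0, and real numbers n, b, S ≥ 1 satisfy η·L ≤ min{(1−α)³/(10α), (1−α)/(10·√(S/(n·b) + 1))}. Let G be the 2×2 matrix with rows [α, 2α²η²L²/(1−α)] and [16α²/(1−α), α + 4α⁴η²L²/(1−α)], and let ς ∈ ℝ² be the row vector (8·(4S/(n·b) + 1), 8·S·α²·η²·L²/(n·b)). Then I₂ − G is invertible and ςᵀ·(I₂ − G)^{−1} ≤ (64·(S/(n·b) + 1)/(1−α), 2α²/(1−α)) entrywise. -/

import Mathlib

noncomputable section

/-- Under `ηL ≤ min{(1−α)³/(10α), (1−α)/(10√(S/(nb)+1))}`, with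
`G = [[α, 2α²η²L²/(1−α)], [16α²/(1−α), α + 4α⁴η²L²/(1−α)]]` and row vector
`ς = (8(4S/(nb)+1), 8Sα²η²L²/(nb))`, the matrix `I₂ − G` is invertible and
`ςᵀ(I₂ − G)⁻¹ ≤ (64(S/(nb)+1)/(1−α), 2α²/(1−α))` entrywise. -/
theorem weighted_neumann_bound (α η L n b S : ℝ)
    (hα : α ∈ Set.Ioo (0 : ℝ) 1) (hη : 0 < η) (hL : 0 < L)
    (hn : 1 ≤ n) (hb : 1 ≤ b) (hS : 1 ≤ S)
    (hstep : η * L ≤ min ((1 - α) ^ 3 / (10 * α))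
      ((1 - α) / (10 * Real.sqrt (S / (n * b) + 1))))
    (G : Matrix (Fin 2) (Fin 2) ℝ)
    (hG : G = !![α, 2 * α ^ 2 * η ^ 2 * L ^ 2 / (1 - α);
                 16 * α ^ 2 / (1 - α), α + 4 * α ^ 4 * η ^ 2 * L ^ 2 / (1 - α)])
    (ς : Fin 2 → ℝ)
    (hς : ς = ![8 * (4 * S / (n * b) + 1), 8 * S * α ^ 2 * η ^ 2 * L ^ 2 / (n * b)]) :
    IsUnit (1 - G) ∧
    ∀ j, Matrix.vecMul ς (1 - G)⁻¹ j ≤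
      ![64 * (S / (n * b) + 1) / (1 - α), 2 * α ^ 2 / (1 - α)] j := by
  obtain ⟨ha0, ha1⟩ := hα
  have hu : 0 < 1 - α := by linarith
  have hnb : 0 < n * b := by positivity
  obtain ⟨h1, h2⟩ := le_min_iff.mp hstep
  obtain ⟨s, hs⟩ : ∃ s, s = S / (n * b) := ⟨_, rfl⟩
  have hs0 : 0 < s := by rw [hs]; positivity
  obtain ⟨x, hx⟩ : ∃ x, x = η ^ 2 * L ^ 2 := ⟨_, rfl⟩
  have hx0 : 0 < x := by rw [hx]; positivity
  obtain ⟨u, hue⟩ : ∃ u, u = 1 - α := ⟨_, rfl⟩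
  rw [← hue] at h1 h2 hu
  rw [← hs] at h2
  have hu1 : u ≤ 1 := by linarith
  have e1 : x * α ^ 2 ≤ u ^ 6 / 100 := by
    rw [le_div_iff₀ (by positivity)] at h1
    have := pow_le_pow_left₀ (by positivity) h1 2
    rw [hx]; nlinarith
  have e2 : x * (s + 1) ≤ u ^ 2 / 100 := by
    have hq : 0 < Real.sqrt (s + 1) := Real.sqrt_pos.mpr (by linarith)
    rw [le_div_iff₀ (by positivity)] at h2
    have := pow_le_pow_left₀ (by positivity) h2 2
    have h3 : Real.sqrt (s + 1) ^ 2 = s + 1 := Real.sq_sqrt (by linarith)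
    have h4 : (η * L * (10 * Real.sqrt (s + 1))) ^ 2 = 100 * (x * (s + 1)) := by
      rw [mul_pow, mul_pow, mul_pow, h3, hx]; ring
    rw [h4] at this
    linarith
  obtain ⟨Q, hQ⟩ : ∃ Q, Q = α ^ 4 * x / u ^ 2 := ⟨_, rfl⟩
  have hQP : α ^ 4 * x = Q * u ^ 2 := by rw [hQ]; field_simp
  have hQ0 : 0 < Q := by rw [hQ]; positivity
  have hQ1 : Q ≤ u ^ 2 / 100 := by
    rw [hQ, div_le_iff₀ (by positivity)]
    have a2 : α ^ 2 ≤ 1 := by nlinarith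
    have u2 : u ^ 2 ≤ 1 := by nlinarith
    calc α ^ 4 * x = α ^ 2 * (x * α ^ 2) := by ring
      _ ≤ 1 * (u ^ 6 / 100) := by gcongr
      _ = u ^ 4 / 100 * u ^ 2 := by ring
      _ ≤ u ^ 4 / 100 * 1 := by gcongr
      _ = _ := by ring
  have hP1 : Q * u ^ 2 ≤ Q := by
    have u2 : u ^ 2 ≤ 1 := by nlinarith
    nlinarith
  obtain ⟨D, hD⟩ : ∃ D, D = u ^ 2 - 4 * (Q * u ^ 2) - 32 * Q := ⟨_, rfl⟩
  have hD1 : 64 / 100 * u ^ 2 ≤ D := by rw [hD]; linarith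
  have hD0 : 0 < D := lt_of_lt_of_le (by positivity) hD1
  have hM : 1 - G = !![u, -(2 * α ^ 2 * x / u); -(16 * α ^ 2 / u), u - 4 * (Q * u ^ 2) / u] := by
    rw [hG, ← hQP, hx, hue]
    ext i j
    fin_cases i <;> fin_cases j <;> simp <;> ring
  have hdet : (1 - G).det = D := by
    rw [hM, Matrix.det_fin_two_of, hD]
    have : (2 * α ^ 2 * x / u) * (16 * α ^ 2 / u) = 32 * Q := by
      rw [hQ]; field_simp; ring
    have h5 : u * (u - 4 * (Q * u ^ 2) / u) = u ^ 2 - 4 * (Q * u ^ 2) := by field_simp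
    rw [h5, neg_mul_neg, this]
  have hinv : (1 - G)⁻¹ = D⁻¹ • !![u - 4 * (Q * u ^ 2) / u, 2 * α ^ 2 * x / u; 16 * α ^ 2 / u, u] := by
    rw [Matrix.inv_def, hdet, hM, Matrix.adjugate_fin_two_of, Ring.inverse_eq_inv', neg_neg, neg_neg]
  have hς' : ς = ![8 * (4 * s + 1), 8 * s * α ^ 2 * x] := by
    rw [hς, hs, hx]
    ext i; fin_cases i <;> simp <;> ring
  refine ⟨(Matrix.isUnit_iff_isUnit_det _).mpr (by rw [hdet]; exact hD0.ne'.isUnit), ?_⟩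
  rw [hinv, hς', ← hs, ← hue, Matrix.vecMul_smul]
  have k0 : D⁻¹ * (8 * (4 * s + 1) * (u - 4 * (Q * u ^ 2) / u) + 8 * s * α ^ 2 * x * (16 * α ^ 2 / u))
      ≤ 64 * (s + 1) / u := by
    have : 8 * (4 * s + 1) * (u - 4 * (Q * u ^ 2) / u) + 8 * s * α ^ 2 * x * (16 * α ^ 2 / u)
      = (8 * (4 * s + 1) * (u ^ 2 - 4 * (Q * u ^ 2)) + 128 * s * (Q * u ^ 2)) / u := by
      rw [← hQP]; field_simp; ring
    rw [this, inv_mul_le_iff₀ hD0, ← mul_div_assoc]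
    gcongr
    have a : 0 < Q * u ^ 2 := by positivity
    have b1 : s * (Q * u ^ 2) ≤ s * (u ^ 2 / 100) := by gcongr; linarith
    have b2 : (s + 1) * (64 / 100 * u ^ 2) ≤ (s + 1) * D := by gcongr
    have b3 : 0 < s * (Q * u ^ 2) := by positivity
    have b4 : 0 < s * u ^ 2 := by positivity
    have b5 : 0 < u ^ 2 := by positivity
    linarith
  have k1 : D⁻¹ * (8 * (4 * s + 1) * (2 * α ^ 2 * x / u) + 8 * s * α ^ 2 * x * u)
      ≤ 2 * α ^ 2 / u := by
    have : 8 * (4 * s + 1) * (2 * α ^ 2 * x / u) + 8 * s * α ^ 2 * x * u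
      = (α ^ 2 * (16 * (4 * s + 1) * x + 8 * (s * x * u ^ 2))) / u := by
      field_simp; ring
    rw [this, inv_mul_le_iff₀ hD0, ← mul_div_assoc]
    refine div_le_div_of_nonneg_right ?_ hu.le
    have u2 : u ^ 2 ≤ 1 := by nlinarith
    have b1 : s * x * u ^ 2 ≤ s * x * 1 := by gcongr
    have b2 : 0 < s * x := by positivity
    have : 16 * (4 * s + 1) * x + 8 * (s * x * u ^ 2) ≤ 2 * D := by
      have b5 : 0 < u ^ 2 := by positivity
      linarith
    have := mul_le_mul_of_nonneg_left this (sq_nonneg α)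
    linarith
  intro j
  fin_cases j
  · simpa [Matrix.vecMul, dotProduct, Fin.sum_univ_two] using k0
  · simpa [Matrix.vecMul, dotProduct, Fin.sum_univ_two] using k1
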